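/- Let ε ∈ ℂ and let K = (K¹,K²) with K¹ = B₃[u] + 2ε D_x(v₂ + 3u v₁ + 2v u₁ + 2u²v) and K² = v₃ + 3u v₂ + 6u₁v₁ + 3u²v₁ − ε(4v v₂ − v₁² + 8u₁v² + 8uv v₁ + 4u²v²). For every γ ∈ ℂ, set f = −(x²u₁ + 2xu − 1, x²v₁ + 2xv + γ) and τ = (1/6)[f, K]. Then [τ,K] ≠ 0 and [[τ,K],K] = 0; hence τ is a one-parameter family of master symmetries of the system u_t = K¹, v_t = K². -/

import Mathlib

open MvPolynomial

/-- The two-component differential ring `𝒜₂ = ℂ[x, u₀, u₁, …, v₀, v₁, …]`: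
variable `none` is `x`, `some (false, k)` is `u_k`, `some (true, k)` is `v_k`. -/
abbrev A2 : Type := MvPolynomial (Option (Bool × ℕ)) ℂ

/-- The variable `x`. -/
noncomputable def Xx : A2 := X none

/-- The variable `u_k`. -/
noncomputable def U (k : ℕ) : A2 := X (some (false, k))

/-- The variable `v_k`. -/
noncomputable def V (k : ℕ) : A2 := X (some (true, k))

/-- The total derivative `D_x = ∂/∂x + Σ_{k≥0} (u_{k+1} ∂/∂u_k + v_{k+1} ∂/∂v_k)`. -/
noncomputable def Dx (P : A2) : A2 :=
  pderiv (none : Option (Bool × ℕ)) P +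
    ∑ᶠ k : ℕ, (U (k + 1) * pderiv (some (false, k)) P +
      V (k + 1) * pderiv (some (true, k)) P)

/-- `frU P Q = P_{u*}(Q) = Σ_k (∂P/∂u_k) D_x^k(Q)`. -/
noncomputable def frU (P Q : A2) : A2 :=
  ∑ᶠ k : ℕ, pderiv (some (false, k)) P * Dx^[k] Q

/-- `frV P Q = P_{v*}(Q) = Σ_k (∂P/∂v_k) D_x^k(Q)`. -/
noncomputable def frV (P Q : A2) : A2 :=
  ∑ᶠ k : ℕ, pderiv (some (true, k)) P * Dx^[k] Q

/-- The Lie bracket of two pairs (evolutionary vector fields). -/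
noncomputable def lieBr2 (P J : A2 × A2) : A2 × A2 :=
  (frU J.1 P.1 + frV J.1 P.2 - frU P.1 J.1 - frV P.1 J.2,
   frU J.2 P.1 + frV J.2 P.2 - frU P.2 J.1 - frV P.2 J.2)

/-- The third-order Burgers flow `B₃[u] = u₃ + 3u u₂ + 3u² u₁ + 3u₁²`. -/
noncomputable def B3 : A2 := U 3 + 3 * U 0 * U 2 + 3 * U 0 ^ 2 * U 1 + 3 * U 1 ^ 2

/-- The total derivative as a derivation of `A2`. -/
noncomputable def totalDeriv : Derivation ℂ A2 A2 :=
  mkDerivation ℂ fun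
    | none => 1
    | some (false, k) => U (k + 1)
    | some (true, k) => V (k + 1)

/-- The evolutionary derivation with characteristic `P`. -/
noncomputable def evol (P : A2 × A2) : Derivation ℂ A2 A2 :=
  mkDerivation ℂ fun
    | none => 0
    | some (false, k) => totalDeriv^[k] P.1
    | some (true, k) => totalDeriv^[k] P.2

theorem finite_support_mul_pderiv (b : Bool) (g : ℕ → A2) (P : A2) :
    (Function.support fun k : ℕ => pderiv (some (b, k)) P * g k).Finite := by
  have hinj : Function.Injective fun k : ℕ => (some (b, k) : Option (Bool × ℕ)) := by
    intro i j h
    simpa using h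
  refine (P.vars.finite_toSet.preimage hinj.injOn).subset fun k hk => ?_
  by_contra hvar
  exact hk (by
    simp [pderiv_eq_zero_of_notMem_vars (i := (some (b, k) : Option (Bool × ℕ))) hvar])

/-- Summing `∂P/∂i * g i` over one family of jet variables is a derivation in `P`. -/
theorem finsum_pderiv_mul_eq (b : Bool) (g : ℕ → A2) (P : A2) :
    ∑ᶠ k : ℕ, pderiv (some (b, k)) P * g k =
      mkDerivation ℂ (fun i : Option (Bool × ℕ) =>
        i.elim 0 fun j => if j.1 = b then g j.2 else 0) P := by
  induction P using MvPolynomial.induction_on with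
  | C a => simp
  | add p q hp hq =>
    rw [map_add, ← hp, ← hq,
      ← finsum_add_distrib (finite_support_mul_pderiv b g p) (finite_support_mul_pderiv b g q)]
    simp only [map_add, add_mul]
  | mul_X p i hp =>
    rw [Derivation.leibniz, ← hp, smul_eq_mul, smul_eq_mul, mkDerivation_X,
      mul_finsum]
    simp only [Derivation.leibniz, smul_eq_mul, add_mul]
    have hX : ∑ᶠ k : ℕ, pderiv (some (b, k)) (X i : A2) * g k =
        i.elim 0 fun j => if j.1 = b then g j.2 else 0 := by
      rcases i with _ | ⟨c, n⟩
      · simp [pderiv_X]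
      · rw [finsum_eq_single _ n]
        · by_cases h : c = b <;> simp [pderiv_X, h]
        · intro k hk
          simp [pderiv_X, hk.symm]
    have h₁ := finite_support_mul_pderiv b (fun k => p * g k) (X i)
    have h₂ := finite_support_mul_pderiv b (fun k => X i * g k) p
    rw [← hX, mul_finsum, ← finsum_add_distrib]
    · exact finsum_congr fun k => by ring
    · exact h₁.subset fun k hk h => hk (by linear_combination h)
    · exact h₂.subset fun k hk h => hk (by linear_combination h)

theorem Dx_eq (P : A2) : Dx P = totalDeriv P := by
  have h : ∀ k : ℕ, U (k + 1) * pderiv (some (false, k)) P +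
      V (k + 1) * pderiv (some (true, k)) P =
      pderiv (some (false, k)) P * U (k + 1) + pderiv (some (true, k)) P * V (k + 1) :=
    fun k => by ring
  rw [Dx, finsum_congr h, finsum_add_distrib (finite_support_mul_pderiv _ (fun k => U (k + 1)) P)
    (finite_support_mul_pderiv _ (fun k => V (k + 1)) P),
    finsum_pderiv_mul_eq _ fun k => U (k + 1), finsum_pderiv_mul_eq _ fun k => V (k + 1),
    ← Derivation.add_apply, ← Derivation.add_apply]
  congr 1
  refine derivation_ext fun i => ?_
  rcases i with _ | ⟨_ | _, k⟩ <;> simp [totalDeriv, pderiv_X]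

theorem Dx_iterate (k : ℕ) : Dx^[k] = totalDeriv^[k] := by
  rw [funext Dx_eq]

theorem frU_add_frV (P Q R : A2) : frU P Q + frV P R = evol (Q, R) P := by
  simp only [frU, frV, Dx_iterate]
  rw [finsum_pderiv_mul_eq _ fun k => totalDeriv^[k] Q,
    finsum_pderiv_mul_eq _ fun k => totalDeriv^[k] R, ← Derivation.add_apply]
  congr 1
  refine derivation_ext fun i => ?_
  rcases i with _ | ⟨_ | _, k⟩ <;> simp [evol]

theorem lieBr2_eq (P J : A2 × A2) :
    lieBr2 P J = (evol P J.1 - evol J P.1, evol P J.2 - evol J P.2) := by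
  simp only [lieBr2, sub_sub, frU_add_frV]

theorem totalDeriv_iterate_smul (k : ℕ) (c : ℂ) (P : A2) :
    totalDeriv^[k] (c • P) = c • totalDeriv^[k] P :=
  Function.Commute.iterate_left (f := totalDeriv) (g := (c • ·)) (totalDeriv.map_smul c) k P

theorem evol_add (P Q : A2 × A2) : evol (P + Q) = evol P + evol Q := by
  refine derivation_ext fun i => ?_
  rcases i with _ | ⟨_ | _, k⟩ <;> simp [evol]

theorem evol_smul (c : ℂ) (P : A2 × A2) : evol (c • P) = c • evol P := by
  refine derivation_ext fun i => ?_
  rcases i with _ | ⟨_ | _, k⟩ <;> simp [evol, totalDeriv_iterate_smul]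

theorem lieBr2_add_left (P Q J : A2 × A2) : lieBr2 (P + Q) J = lieBr2 P J + lieBr2 Q J := by
  simp only [lieBr2_eq, evol_add, Derivation.add_apply, Prod.fst_add, Prod.snd_add, map_add,
    Prod.mk_add_mk]
  congr 1 <;> abel

theorem lieBr2_smul_left (c : ℂ) (P J : A2 × A2) : lieBr2 (c • P) J = c • lieBr2 P J := by
  simp only [lieBr2_eq, evol_smul, Derivation.smul_apply, Prod.smul_fst, Prod.smul_snd,
    Derivation.map_smul, Prod.smul_mk, smul_sub]

theorem derivation_ofNat (d : Derivation ℂ A2 A2) (n : ℕ) [n.AtLeastTwo] :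
    d (ofNat(n) : A2) = 0 :=
  d.map_natCast n

theorem totalDeriv_Xx : totalDeriv Xx = 1 := by simp [totalDeriv, Xx]

theorem totalDeriv_U (k : ℕ) : totalDeriv (U k) = U (k + 1) := by simp [totalDeriv, U]

theorem totalDeriv_V (k : ℕ) : totalDeriv (V k) = V (k + 1) := by simp [totalDeriv, V]

theorem evol_Xx (P : A2 × A2) : evol P Xx = 0 := by simp [evol, Xx]

theorem evol_U (P : A2 × A2) (k : ℕ) : evol P (U k) = totalDeriv^[k] P.1 := by simp [evol, U]

theorem evol_V (P : A2 × A2) (k : ℕ) : evol P (V k) = totalDeriv^[k] P.2 := by simp [evol, V]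

/-- The right-hand side of the coupled third-order system. -/
noncomputable def flow3 (ε : ℂ) : A2 × A2 :=
  (U 3 + 3 * U 0 * U 2 + 3 * U 0 ^ 2 * U 1 + 3 * U 1 ^ 2 +
    2 * C ε * (V 3 + 3 * U 0 * V 2 + 2 * U 2 * V 0 + 4 * U 0 * U 1 * V 0 +
      2 * U 0 ^ 2 * V 1 + 5 * U 1 * V 1),
   V 3 + 3 * U 0 * V 2 + 6 * U 1 * V 1 + 3 * U 0 ^ 2 * V 1 -
    C ε * (4 * V 0 * V 2 - V 1 ^ 2 + 8 * U 1 * V 0 ^ 2 + 8 * U 0 * V 0 * V 1 +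
      4 * U 0 ^ 2 * V 0 ^ 2))

/-- The fifth-order Burgers flow together with its triangular extension to `v`. -/
noncomputable def burgers5 : A2 × A2 :=
  (U 5 + 5 * U 0 * U 4 + 10 * U 0 ^ 2 * U 3 + 15 * U 1 * U 3 + 50 * U 0 * U 1 * U 2 +
    10 * U 0 ^ 3 * U 2 + 10 * U 2 ^ 2 + 30 * U 0 ^ 2 * U 1 ^ 2 + 5 * U 0 ^ 4 * U 1 +
    15 * U 1 ^ 3,
   V 5 + 5 * U 0 * V 4 + 10 * U 0 ^ 2 * V 3 + 15 * U 1 * V 3 + 10 * U 3 * V 1 +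
    40 * U 0 * U 1 * V 2 + 30 * U 0 * U 2 * V 1 + 10 * U 0 ^ 3 * V 2 + 15 * U 2 * V 2 +
    40 * U 0 ^ 2 * U 1 * V 1 + 5 * U 0 ^ 4 * V 1 + 35 * U 1 ^ 2 * V 1)

/-- The fifth-order flow that couples back from `v` to `u`. -/
noncomputable def coupling5 : A2 × A2 :=
  (2 * V 5 + 10 * U 0 * V 4 + 4 * U 4 * V 0 + 16 * U 0 * U 3 * V 0 + 18 * U 0 ^ 2 * V 3 +
    28 * U 1 * V 3 + 18 * U 3 * V 1 + 78 * U 0 * U 1 * V 2 + 58 * U 0 * U 2 * V 1 +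
    24 * U 0 ^ 2 * U 2 * V 0 + 14 * U 0 ^ 3 * V 2 + 40 * U 1 * U 2 * V 0 + 32 * U 2 * V 2 +
    48 * U 0 * U 1 ^ 2 * V 0 + 66 * U 0 ^ 2 * U 1 * V 1 + 16 * U 0 ^ 3 * U 1 * V 0 +
    4 * U 0 ^ 4 * V 1 + 54 * U 1 ^ 2 * V 1,
   -4 * V 0 * V 4 - 16 * U 0 * V 0 * V 3 - 8 * U 3 * V 0 ^ 2 + 2 * V 1 * V 3 -
    24 * U 0 * U 2 * V 0 ^ 2 + 2 * U 0 * V 1 * V 2 - 24 * U 0 ^ 2 * V 0 * V 2 -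
    40 * U 1 * V 0 * V 2 - 24 * U 2 * V 0 * V 1 - V 2 ^ 2 - 64 * U 0 * U 1 * V 0 * V 1 -
    32 * U 0 ^ 2 * U 1 * V 0 ^ 2 + U 0 ^ 2 * V 1 ^ 2 - 16 * U 0 ^ 3 * V 0 * V 1 +
    10 * U 1 * V 1 ^ 2 - 28 * U 1 ^ 2 * V 0 ^ 2 - 4 * U 0 ^ 4 * V 0 ^ 2)

/-- The bracket of the generator `-(x²u₁ + 2xu - 1, x²v₁ + 2xv + γ)` with `flow3 ε`. -/
noncomputable def master6 (ε γ : ℂ) : A2 × A2 :=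
  (-6 * U 3 * Xx - 18 * U 0 * U 2 * Xx - 9 * U 2 - 24 * U 0 * U 1 - 18 * U 0 ^ 2 * U 1 * Xx -
    18 * U 1 ^ 2 * Xx - 6 * U 0 ^ 3 - 12 * C ε * V 3 * Xx - 36 * C ε * U 0 * V 2 * Xx -
    24 * C ε * U 2 * V 0 * Xx - 18 * C ε * V 2 - 48 * C ε * U 0 * U 1 * V 0 * Xx -
    48 * C ε * U 0 * V 1 - 24 * C ε * U 0 ^ 2 * V 1 * Xx - 36 * C ε * U 1 * V 0 -
    60 * C ε * U 1 * V 1 * Xx - 24 * C ε * U 0 ^ 2 * V 0 - 4 * C ε * C γ * U 2 -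
    8 * C ε * C γ * U 0 * U 1,
   -6 * V 3 * Xx - 18 * U 0 * V 2 * Xx - 9 * V 2 - 24 * U 0 * V 1 - 18 * U 0 ^ 2 * V 1 * Xx -
    12 * U 1 * V 0 - 36 * U 1 * V 1 * Xx - 6 * U 0 ^ 2 * V 0 + 24 * C ε * V 0 * V 2 * Xx +
    48 * C ε * U 0 * V 0 * V 1 * Xx + 48 * C ε * U 1 * V 0 ^ 2 * Xx + 12 * C ε * V 0 * V 1 -
    6 * C ε * V 1 ^ 2 * Xx + 24 * C ε * U 0 * V 0 ^ 2 + 24 * C ε * U 0 ^ 2 * V 0 ^ 2 * Xx +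
    4 * C ε * C γ * V 2 + 8 * C ε * C γ * U 0 * V 1 + 16 * C ε * C γ * U 1 * V 0 +
    8 * C ε * C γ * U 0 ^ 2 * V 0)

set_option maxHeartbeats 1000000 in
theorem lieBr2_burgers5_flow3 (ε : ℂ) : lieBr2 burgers5 (flow3 ε) = 0 := by
  refine Prod.ext ?_ ?_ <;>
    simp only [burgers5, flow3, lieBr2_eq, evol_U, evol_V, totalDeriv_U, totalDeriv_V,
      Function.iterate_succ_apply', Function.iterate_zero_apply, map_add, map_sub,
      Derivation.leibniz, Derivation.leibniz_pow, derivation_ofNat, derivation_C, smul_eq_mul,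
      nsmul_eq_mul, Nat.reduceSub, pow_one, mul_zero, add_zero, zero_add, Nat.cast_ofNat,
      Nat.reduceAdd, Prod.fst_zero, Prod.snd_zero] <;>
    ring

set_option maxHeartbeats 1000000 in
theorem lieBr2_coupling5_flow3 (ε : ℂ) : lieBr2 coupling5 (flow3 ε) = 0 := by
  refine Prod.ext ?_ ?_ <;>
    simp only [coupling5, flow3, lieBr2_eq, evol_U, evol_V, totalDeriv_U, totalDeriv_V,
      Function.iterate_succ_apply', Function.iterate_zero_apply, map_add, map_sub,
      Derivation.leibniz, Derivation.leibniz_pow, derivation_ofNat, derivation_C, smul_eq_mul,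
      nsmul_eq_mul, Nat.reduceSub, pow_one, mul_zero, add_zero, zero_add, Nat.cast_ofNat,
      Nat.reduceAdd, map_neg, map_zero, Prod.fst_zero, Prod.snd_zero] <;>
    ring

theorem lieBr2_generator_flow3 (ε γ : ℂ) :
    lieBr2 (-(Xx ^ 2 * U 1 + 2 * Xx * U 0 - 1), -(Xx ^ 2 * V 1 + 2 * Xx * V 0 + C γ)) (flow3 ε) =
      master6 ε γ := by
  refine Prod.ext ?_ ?_ <;>
    simp only [master6, flow3, evol_Xx, totalDeriv_Xx, Derivation.map_one_eq_zero, map_neg,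
      map_zero, mul_one, lieBr2_eq, evol_U, evol_V, totalDeriv_U, totalDeriv_V,
      Function.iterate_succ_apply', Function.iterate_zero_apply, map_add, map_sub,
      Derivation.leibniz, Derivation.leibniz_pow, derivation_ofNat, derivation_C, smul_eq_mul,
      nsmul_eq_mul, Nat.reduceSub, pow_one, mul_zero, add_zero, zero_add, Nat.cast_ofNat,
      Nat.reduceAdd] <;>
    ring

set_option maxHeartbeats 1000000 in
theorem lieBr2_master6_flow3 (ε γ : ℂ) :
    lieBr2 (master6 ε γ) (flow3 ε) =
      (-18 : ℂ) • burgers5 + (ε * (8 * ε * γ - 36)) • coupling5 := by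
  refine Prod.ext ?_ ?_ <;>
    simp only [master6, flow3, burgers5, coupling5, evol_Xx, totalDeriv_Xx, map_neg, map_zero,
      mul_one, lieBr2_eq, evol_U, evol_V, totalDeriv_U, totalDeriv_V,
      Function.iterate_succ_apply', Function.iterate_zero_apply, map_add, map_sub,
      Derivation.leibniz, Derivation.leibniz_pow, derivation_ofNat, derivation_C, smul_eq_mul,
      nsmul_eq_mul, Nat.reduceSub, pow_one, mul_zero, add_zero, zero_add, Nat.cast_ofNat,
      Nat.reduceAdd, Prod.fst_add, Prod.snd_add, Prod.smul_fst, Prod.smul_snd, smul_eq_C_mul,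
      map_mul, map_ofNat] <;>
    ring

/-- For every `γ ∈ ℂ`, the pair `τ = (1/6)[f,K]` with
`f = −(x²u₁ + 2xu − 1, x²v₁ + 2xv + γ)` is a master symmetry of System (12):
`[τ,K] ≠ 0` and `[[τ,K],K] = 0`. -/
theorem system12_master_symmetry_family (ε γ : ℂ) :
    let K : A2 × A2 :=
      (B3 + 2 * C ε * Dx (V 2 + 3 * U 0 * V 1 + 2 * V 0 * U 1 + 2 * U 0 ^ 2 * V 0),
       V 3 + 3 * U 0 * V 2 + 6 * U 1 * V 1 + 3 * U 0 ^ 2 * V 1 -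
         C ε * (4 * V 0 * V 2 - V 1 ^ 2 + 8 * U 1 * V 0 ^ 2 + 8 * U 0 * V 0 * V 1 +
           4 * U 0 ^ 2 * V 0 ^ 2))
    let f : A2 × A2 :=
      (-(Xx ^ 2 * U 1 + 2 * Xx * U 0 - 1), -(Xx ^ 2 * V 1 + 2 * Xx * V 0 + C γ))
    let τ : A2 × A2 := (1 / 6 : ℂ) • lieBr2 f K
    lieBr2 τ K ≠ 0 ∧ lieBr2 (lieBr2 τ K) K = 0 := by
  intro K f τ
  have hK : K = flow3 ε := by
    refine Prod.ext ?_ rfl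
    simp only [K, B3, flow3, Dx_eq, map_add, Derivation.leibniz, Derivation.leibniz_pow,
      derivation_ofNat, totalDeriv_U, totalDeriv_V, smul_eq_mul, nsmul_eq_mul]
    ring
  have hτ : lieBr2 τ K =
      (1 / 6 : ℂ) • ((-18 : ℂ) • burgers5 + (ε * (8 * ε * γ - 36)) • coupling5) := by
    rw [← lieBr2_master6_flow3, ← lieBr2_generator_flow3, ← lieBr2_smul_left, ← hK]
  rw [hτ]
  constructor
  · intro h
    have h₁ := congrArg (fun P : A2 × A2 =>
      aeval (fun i : Option (Bool × ℕ) => if i = some (false, 5) then (1 : ℂ) else 0) P.1) h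
    norm_num [burgers5, coupling5, U, V] at h₁
  · rw [hK, lieBr2_smul_left, lieBr2_add_left, lieBr2_smul_left, lieBr2_smul_left,
      lieBr2_burgers5_flow3, lieBr2_coupling5_flow3]
    simp
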